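/- Let b > 0 be a real number and n ≥ 1 an integer. Then det(V_n(b)) > 0; in particular, V_n(b) is invertible. -/

import Mathlib

open Real Matrix Finset

noncomputable def V (b : ℝ) (n : ℕ) : Matrix (Fin n) (Fin n) ℝ :=
  Matrix.of fun i j =>
    if (i : ℕ) = (j : ℕ) then b + 1
    else if (j : ℕ) = (i : ℕ) + 1 then 1
    else if (i : ℕ) = (j : ℕ) + 1 then b
    else 0

theorem V_submatrix_succ (b : ℝ) (n : ℕ) :
    (V b (n + 1)).submatrix Fin.succ Fin.succ = V b n := by
  ext i j
  simp [V]

/-- The three-term recurrence for the determinants (continuants) of `V b n`. -/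
theorem det_V_add_two (b : ℝ) (n : ℕ) :
    (V b (n + 2)).det = (b + 1) * (V b (n + 1)).det - b * (V b n).det := by
  have hminor : ((V b (n + 2)).submatrix Fin.succ (Fin.succAbove 1)).det = b * (V b n).det := by
    rw [det_succ_column_zero, Fin.sum_univ_succ, Finset.sum_eq_zero]
    · have hsub : ((V b (n + 2)).submatrix Fin.succ (Fin.succAbove 1)).submatrix
          (Fin.succAbove 0) Fin.succ = V b n := by
        ext i j
        simp [V, Fin.succAbove, Fin.lt_def]
      rw [hsub]
      simp [V]
    · intro i _
      simp [V]
  rw [det_succ_row_zero, Fin.sum_univ_succ, Fin.sum_univ_succ, Finset.sum_eq_zero]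
  · rw [show Fin.succ (0 : Fin (n + 1)) = 1 from rfl, hminor, Fin.succAbove_zero,
      V_submatrix_succ]
    simp [V]
    ring
  · intro i _
    simp [V]

theorem det_V_succ (b : ℝ) (n : ℕ) : (V b (n + 1)).det = b * (V b n).det + 1 := by
  induction n with
  | zero => simp [V]
  | succ n ih =>
    rw [det_V_add_two, ih]
    ring

theorem det_V_pos (b : ℝ) (hb : 0 < b) (n : ℕ) : 0 < (V b n).det := by
  induction n with
  | zero => simp
  | succ n ih =>
    rw [det_V_succ]
    positivity

theorem stmt18 (b : ℝ) (hb : 0 < b) (n : ℕ) (hn : 1 ≤ n) :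
    0 < (V b n).det ∧ IsUnit (V b n) :=
  ⟨det_V_pos b hb n, (isUnit_iff_isUnit_det _).2 (det_V_pos b hb n).ne'.isUnit⟩
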